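/- For every s > 0 and every k ≥ 1: p_0^{s/(s+r)} · max{a(s)^k, b(s)^k} ≤ Σ_{σ∈Ω_k} h(σ)^{s/(s+r)} ≤ p_0^{s/(s+r)} · Σ_{h=0}^{k−1} a(s)^{k−h} b(s)^h + b(s)^k. -/

import Mathlib

open MeasureTheory Filter

/-- The `n`-th quantization error of order `r` of a Borel measure `P` on `ℝ^q`:
the infimum of `(∫ d(x,α)^r dP)^{1/r}` over finite sets `α` with `1 ≤ card α ≤ n`. -/
noncomputable def quantErr {q : ℕ} (P : Measure (EuclideanSpace ℝ (Fin q)))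
    (n : ℕ) (r : ℝ) : ℝ :=
  sInf ((fun α : Finset (EuclideanSpace ℝ (Fin q)) =>
      (∫ x, Metric.infDist x (α : Set (EuclideanSpace ℝ (Fin q))) ^ r ∂P) ^ (1 / r)) ''
    {α : Finset (EuclideanSpace ℝ (Fin q)) | α.Nonempty ∧ α.card ≤ n})

/-- Product of weights `g` along a word `σ` (equals `1` for the empty word). -/
noncomputable def prodw {N : ℕ} (g : Fin N → ℝ) (σ : List (Fin N)) : ℝ := (σ.map g).prod

/-- The composition `f_{σ_1} ∘ ⋯ ∘ f_{σ_n}` along a word `σ`. -/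
def wordMap {q N : ℕ} (f : Fin N → EuclideanSpace ℝ (Fin q) → EuclideanSpace ℝ (Fin q))
    (σ : List (Fin N)) : EuclideanSpace ℝ (Fin q) → EuclideanSpace ℝ (Fin q) :=
  σ.foldr (fun i g => f i ∘ g) id

/-- `h(σ) = h^{(1)}(σ) + h^{(2)}(σ)` where
`h^{(1)}(σ) = Σ_{j=0}^{|σ|-1} p0 p_{σ|_j} t_{σ^{(l)}_{-j}} s_σ^r` and `h^{(2)}(σ) = p_σ s_σ^r`. -/
noncomputable def hfun {N : ℕ} (r p0 : ℝ) (s t p : Fin N → ℝ) (σ : List (Fin N)) : ℝ :=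
  (∑ j ∈ Finset.range σ.length, p0 * prodw p (σ.take j) * prodw t (σ.drop j)) * prodw s σ ^ r
    + prodw p σ * prodw s σ ^ r

/-- `η̲_r := min_{1 ≤ i ≤ N} min{p0 t_i + p_i, t_i} · s_i^r`. -/
noncomputable def etaLow {N : ℕ} (r p0 : ℝ) (s t p : Fin N → ℝ) : ℝ :=
  ⨅ i, min (p0 * t i + p i) (t i) * s i ^ r

/-- The finite maximal antichain `Λ_{k,r} = {σ : h(σ|_{|σ|-1}) ≥ η̲_r/k > h(σ)}`. -/
def Lam {N : ℕ} (r p0 : ℝ) (s t p : Fin N → ℝ) (k : ℕ) : Set (List (Fin N)) :=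
  {σ | σ ≠ [] ∧ etaLow r p0 s t p / k ≤ hfun r p0 s t p σ.dropLast ∧
    hfun r p0 s t p σ < etaLow r p0 s t p / k}

/-- `a(x) = Σ_i (t_i s_i^r)^{x/(x+r)}` (also used for `b` with `p` in place of `t`). -/
noncomputable def afun {N : ℕ} (r : ℝ) (s t : Fin N → ℝ) (x : ℝ) : ℝ :=
  ∑ i, (t i * s i ^ r) ^ (x / (x + r))

theorem sum_ofFn_succ {α : Type*} [Fintype α] (k : ℕ) (F : List α → ℝ) :
    ∑ σ : Fin (k + 1) → α, F (List.ofFn σ) =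
      ∑ a, ∑ σ : Fin k → α, F (a :: List.ofFn σ) := by
  rw [← (Fin.consEquiv fun _ : Fin (k + 1) => α).sum_comp, Fintype.sum_prod_type]
  simp [Fin.consEquiv]

theorem prodw_nil {N : ℕ} (g : Fin N → ℝ) : prodw g [] = 1 := by
  simp [prodw]

theorem prodw_cons {N : ℕ} (g : Fin N → ℝ) (i : Fin N) (σ : List (Fin N)) :
    prodw g (i :: σ) = g i * prodw g σ := by
  simp [prodw]

theorem prodw_nonneg {N : ℕ} {g : Fin N → ℝ} (hg : ∀ i, 0 ≤ g i) (σ : List (Fin N)) :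
    0 ≤ prodw g σ := by
  induction σ with
  | nil => simp [prodw_nil]
  | cons i σ ih => rw [prodw_cons]; exact mul_nonneg (hg i) ih

theorem prodw_take_mul_prodw_drop {N : ℕ} (g : Fin N → ℝ) (j : ℕ) (σ : List (Fin N)) :
    prodw g (σ.take j) * prodw g (σ.drop j) = prodw g σ := by
  simp only [prodw, ← List.prod_append, ← List.map_append, List.take_append_drop]

theorem prodw_rpow {N : ℕ} {g : Fin N → ℝ} (hg : ∀ i, 0 ≤ g i) (c : ℝ) (σ : List (Fin N)) :
    prodw g σ ^ c = prodw (fun i => g i ^ c) σ := by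
  induction σ with
  | nil => simp [prodw_nil]
  | cons i σ ih => rw [prodw_cons, prodw_cons, Real.mul_rpow (hg i) (prodw_nonneg hg σ), ih]

theorem prodw_mul {N : ℕ} (g g' : Fin N → ℝ) (σ : List (Fin N)) :
    prodw (fun i => g i * g' i) σ = prodw g σ * prodw g' σ :=
  List.prod_map_mul

theorem sum_prodw_ofFn {N : ℕ} (g : Fin N → ℝ) (k : ℕ) :
    ∑ σ : Fin k → Fin N, prodw g (List.ofFn σ) = (∑ i, g i) ^ k := by
  induction k with
  | zero => simp [prodw_nil]
  | succ k ih =>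
    rw [sum_ofFn_succ k (prodw g)]
    simp only [prodw_cons, ← Finset.mul_sum, ih, ← Finset.sum_mul]
    ring

theorem sum_prodw_take_mul_prodw_drop {N : ℕ} (g g' : Fin N → ℝ) {k j : ℕ} (hj : j ≤ k) :
    ∑ σ : Fin k → Fin N, prodw g ((List.ofFn σ).take j) * prodw g' ((List.ofFn σ).drop j) =
      (∑ i, g i) ^ j * (∑ i, g' i) ^ (k - j) := by
  induction k generalizing j with
  | zero => simp_all [prodw_nil]
  | succ k ih =>
    cases j with
    | zero =>
      simpa only [List.take_zero, List.drop_zero, prodw_nil, one_mul, pow_zero, Nat.sub_zero]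
        using sum_prodw_ofFn g' (k + 1)
    | succ j =>
      rw [sum_ofFn_succ k fun l => prodw g (l.take (j + 1)) * prodw g' (l.drop (j + 1))]
      simp only [List.take_succ_cons, List.drop_succ_cons, prodw_cons, mul_assoc,
        ← Finset.mul_sum, ih (Nat.le_of_succ_le_succ hj), ← Finset.sum_mul,
        Nat.add_sub_add_right]
      ring

theorem rpow_sum_le_sum_rpow {ι : Type*} (A : Finset ι) {f : ι → ℝ} (hf : ∀ i, 0 ≤ f i)
    {c : ℝ} (hc : 0 < c) (hc1 : c ≤ 1) : (∑ i ∈ A, f i) ^ c ≤ ∑ i ∈ A, f i ^ c := by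
  classical
  induction A using Finset.induction_on with
  | empty => simp [Real.zero_rpow hc.ne']
  | insert i A hi ih =>
    rw [Finset.sum_insert hi, Finset.sum_insert hi]
    exact (Real.rpow_add_le_add_rpow (hf i) (Finset.sum_nonneg fun i _ => hf i) hc.le hc1).trans
      (by gcongr)

theorem hfun_eq_sum_prodw {N : ℕ} {r : ℝ} (p0 : ℝ) {s : Fin N → ℝ} (hs : ∀ i, 0 ≤ s i)
    (t p : Fin N → ℝ) (σ : List (Fin N)) :
    hfun r p0 s t p σ =
      (∑ j ∈ Finset.range σ.length, p0 * (prodw (fun i => p i * s i ^ r) (σ.take j) *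
        prodw (fun i => t i * s i ^ r) (σ.drop j))) + prodw (fun i => p i * s i ^ r) σ := by
  simp only [hfun, prodw_mul p, prodw_mul t, prodw_rpow hs, Finset.sum_mul]
  congr 1
  refine Finset.sum_congr rfl fun j _ => ?_
  rw [← prodw_take_mul_prodw_drop (fun i => s i ^ r) j σ]
  ring

/-- Lemma (Zhu): for every `s > 0` and `k ≥ 1`,
`p_0^{s/(s+r)} max{a(s)^k, b(s)^k} ≤ Σ_{σ∈Ω_k} h(σ)^{s/(s+r)}
  ≤ p_0^{s/(s+r)} Σ_{h=0}^{k-1} a(s)^{k-h} b(s)^h + b(s)^k`. -/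
theorem sum_h_pow_over_level_bounds
    (N : ℕ) (hN : 2 ≤ N) (r : ℝ) (hr : 0 < r)
    (s : Fin N → ℝ) (hs : ∀ i, s i ∈ Set.Ioo (0 : ℝ) 1)
    (t : Fin N → ℝ) (ht : ∀ i, 0 < t i) (ht1 : ∑ i, t i = 1)
    (p0 : ℝ) (p : Fin N → ℝ) (hp0 : 0 < p0) (hp : ∀ i, 0 < p i)
    (hp1 : p0 + ∑ i, p i = 1)
    :
    ∀ x : ℝ, 0 < x → ∀ k : ℕ, 1 ≤ k →
      p0 ^ (x / (x + r)) * max (afun r s t x ^ k) (afun r s p x ^ k)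
          ≤ (∑ σ : Fin k → Fin N, hfun r p0 s t p (List.ofFn σ) ^ (x / (x + r))) ∧
      (∑ σ : Fin k → Fin N, hfun r p0 s t p (List.ofFn σ) ^ (x / (x + r)))
          ≤ p0 ^ (x / (x + r)) * (∑ j ∈ Finset.range k, afun r s t x ^ (k - j) * afun r s p x ^ j)
            + afun r s p x ^ k := by
  intro x hx k hk
  set c := x / (x + r) with hc_def
  have hc : 0 < c := by positivity
  have hc1 : c ≤ 1 := by rw [hc_def, div_le_one (by positivity)]; linarith
  have hs0 : ∀ i, 0 ≤ s i := fun i => (hs i).1.le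
  set u : Fin N → ℝ := fun i => t i * s i ^ r
  set v : Fin N → ℝ := fun i => p i * s i ^ r
  have hu : ∀ i, 0 ≤ u i := fun i => mul_nonneg (ht i).le (Real.rpow_nonneg (hs0 i) r)
  have hv : ∀ i, 0 ≤ v i := fun i => mul_nonneg (hp i).le (Real.rpow_nonneg (hs0 i) r)
  have hp01 : p0 ≤ 1 := by linarith [Finset.sum_nonneg fun i (_ : i ∈ Finset.univ) => (hp i).le]
  have hterm : ∀ (σ : List (Fin N)) (j : ℕ),
      0 ≤ p0 * (prodw v (σ.take j) * prodw u (σ.drop j)) := fun σ j =>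
    mul_nonneg hp0.le (mul_nonneg (prodw_nonneg hv _) (prodw_nonneg hu _))
  have hrpow : ∀ (σ : List (Fin N)) (j : ℕ),
      (p0 * (prodw v (σ.take j) * prodw u (σ.drop j))) ^ c =
        p0 ^ c * (prodw (fun i => v i ^ c) (σ.take j) * prodw (fun i => u i ^ c) (σ.drop j)) :=
    fun σ j => by
      rw [Real.mul_rpow hp0.le (mul_nonneg (prodw_nonneg hv _) (prodw_nonneg hu _)),
        Real.mul_rpow (prodw_nonneg hv _) (prodw_nonneg hu _), prodw_rpow hv, prodw_rpow hu]
  have hA : afun r s t x = ∑ i, u i ^ c := rfl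
  have hB : afun r s p x = ∑ i, v i ^ c := rfl
  have hh : ∀ σ : Fin k → Fin N, hfun r p0 s t p (List.ofFn σ) =
      (∑ j ∈ Finset.range k, p0 * (prodw v ((List.ofFn σ).take j) *
        prodw u ((List.ofFn σ).drop j))) + prodw v (List.ofFn σ) := fun σ => by
    rw [hfun_eq_sum_prodw p0 hs0, List.length_ofFn]
  refine ⟨?_, ?_⟩
  · rw [mul_max_of_nonneg _ _ (Real.rpow_nonneg hp0.le c), hA, hB, ← sum_prodw_ofFn,
      ← sum_prodw_ofFn, Finset.mul_sum, Finset.mul_sum]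
    refine max_le (Finset.sum_le_sum fun σ _ => ?_) (Finset.sum_le_sum fun σ _ => ?_)
    · rw [← prodw_rpow hu, ← Real.mul_rpow hp0.le (prodw_nonneg hu _), hh]
      refine Real.rpow_le_rpow (mul_nonneg hp0.le (prodw_nonneg hu _)) ?_ hc.le
      have h0 := Finset.single_le_sum (fun j _ => hterm (List.ofFn σ) j)
        (Finset.mem_range.2 hk)
      simp only [List.take_zero, List.drop_zero, prodw_nil, one_mul] at h0
      linarith [prodw_nonneg hv (List.ofFn σ)]
    · rw [← prodw_rpow hv, ← Real.mul_rpow hp0.le (prodw_nonneg hv _), hh]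
      refine Real.rpow_le_rpow (mul_nonneg hp0.le (prodw_nonneg hv _)) ?_ hc.le
      exact (mul_le_of_le_one_left (prodw_nonneg hv _) hp01).trans
        (le_add_of_nonneg_left (Finset.sum_nonneg fun j _ => hterm _ j))
  · calc ∑ σ : Fin k → Fin N, hfun r p0 s t p (List.ofFn σ) ^ c
        ≤ ∑ σ : Fin k → Fin N, ((∑ j ∈ Finset.range k, p0 ^ c *
            (prodw (fun i => v i ^ c) ((List.ofFn σ).take j) *
              prodw (fun i => u i ^ c) ((List.ofFn σ).drop j))) +
            prodw (fun i => v i ^ c) (List.ofFn σ)) := by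
          refine Finset.sum_le_sum fun σ _ => ?_
          rw [hh, ← prodw_rpow hv, ← Finset.sum_congr rfl fun j _ => hrpow (List.ofFn σ) j]
          exact (Real.rpow_add_le_add_rpow (Finset.sum_nonneg fun j _ => hterm _ j)
            (prodw_nonneg hv _) hc.le hc1).trans
            (by gcongr; exact rpow_sum_le_sum_rpow _ (hterm _) hc hc1)
      _ = p0 ^ c * (∑ j ∈ Finset.range k, afun r s t x ^ (k - j) * afun r s p x ^ j)
            + afun r s p x ^ k := by
          rw [Finset.sum_add_distrib, Finset.sum_comm, sum_prodw_ofFn, hA, hB, Finset.mul_sum]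
          congr 1
          refine Finset.sum_congr rfl fun j hj => ?_
          rw [← Finset.mul_sum, sum_prodw_take_mul_prodw_drop _ _ (Finset.mem_range.1 hj).le,
            mul_comm ((∑ i, v i ^ c) ^ j)]
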